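/- arXiv:0705.1342 — 2 statements merged into one kernel-verified Lean document; each statement's English description precedes it below -/
import Mathlib

section
/- Let {a_v}_{v∈𝒱} be a uniform random point of the sphere of radius √2 in ℝ^𝒱, let X be an independent uniform random point of 𝕋^n, and let f(x) = Re(Σ_{v∈𝒱} a_v e^{2πi⟨Bv,x⟩}). Then 𝔼[ ‖∇_B f(X)‖_B⁴ ] = (8π⁴/(|𝒱|(|𝒱|+2))) · [ 3 Σ_{v∈𝒱} ‖v‖_B⁴ + 2 (Σ_{v∈𝒱} ‖v‖_B²)² + 4 Σ_{v,w∈𝒱} (v,w)_B² ], where the expectation is over both the coefficients and X. -/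
open MeasureTheory ProbabilityTheory Real Finset Matrix

noncomputable section

/-- total variation distance between two (Borel) measures on ℝ -/
def dTV (μ ν : MeasureTheory.Measure ℝ) : ℝ :=
  ⨆ s : {s : Set ℝ // MeasurableSet s}, |(μ s.1).toReal - (ν s.1).toReal|

/-- uniform probability measure on the unit sphere of a Euclidean space -/
def sphereUniform (ι : Type*) [Fintype ι] :
    MeasureTheory.Measure (Metric.sphere (0 : EuclideanSpace ℝ ι) 1) :=
  ((volume : MeasureTheory.Measure (EuclideanSpace ℝ ι)).toSphere Set.univ)⁻¹ •
    (volume : MeasureTheory.Measure (EuclideanSpace ℝ ι)).toSphere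

/-- the uniform probability measure on the flat torus `ℝ^n/ℤ^n`, modelled by Lebesgue
measure on the fundamental domain `[0,1)^n`. -/
def torusMeasure (n : ℕ) : MeasureTheory.Measure (Fin n → ℝ) :=
  volume.restrict (Set.univ.pi fun _ => Set.Ico (0 : ℝ) 1)

/-- the uniform probability distribution of the coefficients: a uniform random point of
the sphere of radius `√2` in `ℝ^𝒱`. -/
def coeffMeasure {n : ℕ} (𝒱 : Finset (Fin n → ℝ)) : MeasureTheory.Measure (↥𝒱 → ℝ) :=
  MeasureTheory.Measure.map
    (fun c : Metric.sphere (0 : EuclideanSpace ℝ ↥𝒱) 1 =>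
      fun v => Real.sqrt 2 * (c : EuclideanSpace ℝ ↥𝒱) v)
    (sphereUniform ↥𝒱)

/-- `f(x) = Re ∑_{v ∈ 𝒱} a_v e^{2πi⟨Bv,x⟩}` -/
def torusFun {n : ℕ} (B : Matrix (Fin n) (Fin n) ℝ) (𝒱 : Finset (Fin n → ℝ))
    (a : ↥𝒱 → ℝ) (x : Fin n → ℝ) : ℝ :=
  (∑ v : ↥𝒱, (a v : ℂ) *
    Complex.exp (2 * π * Complex.I * ((B.mulVec v ⬝ᵥ x : ℝ) : ℂ))).re

/-- `∇_B f(x) = −Im(∑_{v∈𝒱} 2π a_v e^{2πi⟨Bv,x⟩} v)` -/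
def gradB {n : ℕ} (B : Matrix (Fin n) (Fin n) ℝ) (𝒱 : Finset (Fin n → ℝ))
    (a : ↥𝒱 → ℝ) (x : Fin n → ℝ) : Fin n → ℝ := fun k =>
  -(∑ v : ↥𝒱, 2 * π * (a v : ℂ) *
      Complex.exp (2 * π * Complex.I * ((B.mulVec v ⬝ᵥ x : ℝ) : ℂ)) *
      ((v : Fin n → ℝ) k : ℂ)).im

/-- `‖w‖_B² = ⟨Bw,w⟩` -/
def normBsq {n : ℕ} (B : Matrix (Fin n) (Fin n) ℝ) (w : Fin n → ℝ) : ℝ :=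
  B.mulVec w ⬝ᵥ w

end

section

section SphereMoments

variable {ι : Type*} [Fintype ι]

/-- The action of a linear isometry on the unit sphere. -/
noncomputable def sphereMap (R : EuclideanSpace ℝ ι ≃ₗᵢ[ℝ] EuclideanSpace ℝ ι)
    (c : Metric.sphere (0 : EuclideanSpace ℝ ι) 1) : Metric.sphere (0 : EuclideanSpace ℝ ι) 1 :=
  ⟨R c, by simp⟩

lemma continuous_sphereMap (R : EuclideanSpace ℝ ι ≃ₗᵢ[ℝ] EuclideanSpace ℝ ι) :
    Continuous (sphereMap R) :=
  (R.continuous.comp continuous_subtype_val).subtype_mk _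

open scoped Pointwise in
lemma map_sphereMap_toSphere (R : EuclideanSpace ℝ ι ≃ₗᵢ[ℝ] EuclideanSpace ℝ ι) :
    (volume : Measure (EuclideanSpace ℝ ι)).toSphere.map (sphereMap R) =
      (volume : Measure (EuclideanSpace ℝ ι)).toSphere := by
  ext s hs
  have hm := (continuous_sphereMap R).measurable
  rw [Measure.map_apply hm hs, Measure.toSphere_apply' _ (hm hs), Measure.toSphere_apply' _ hs]
  congr 1
  have hpre : Set.Ioo (0 : ℝ) 1 • ((↑) '' (sphereMap R ⁻¹' s) : Set (EuclideanSpace ℝ ι)) =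
      R ⁻¹' (Set.Ioo (0 : ℝ) 1 • ((↑) '' s)) := by
    ext x
    simp only [Set.mem_smul, Set.mem_image, Set.mem_preimage]
    constructor
    · rintro ⟨r, hr, _, ⟨c, hc, rfl⟩, rfl⟩
      exact ⟨r, hr, _, ⟨_, hc, rfl⟩, by simp [sphereMap]⟩
    · rintro ⟨r, hr, _, ⟨c, hc, rfl⟩, h⟩
      refine ⟨r, hr, _, ⟨sphereMap R.symm c, ?_, rfl⟩, ?_⟩
      · have : sphereMap R (sphereMap R.symm c) = c := by ext1; simp [sphereMap]
        rwa [this]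
      · apply R.injective
        rw [← h]
        simp [sphereMap]
  rw [hpre]
  exact R.measurePreserving.measure_preimage_equiv (f := R.toMeasurableEquiv) _

lemma map_sphereMap_sphereUniform (R : EuclideanSpace ℝ ι ≃ₗᵢ[ℝ] EuclideanSpace ℝ ι) :
    (sphereUniform ι).map (sphereMap R) = sphereUniform ι := by
  rw [sphereUniform, Measure.map_smul, map_sphereMap_toSphere]

instance isProbabilityMeasure_sphereUniform [Nonempty ι] : IsProbabilityMeasure (sphereUniform ι) := by
  constructor
  rw [sphereUniform, Measure.smul_apply, smul_eq_mul]
  refine ENNReal.inv_mul_cancel ?_ (measure_ne_top _ _)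
  rw [Ne, Measure.measure_univ_eq_zero]
  exact Measure.toSphere_ne_zero _

lemma integrable_sphereUniform [Nonempty ι]
    {g : Metric.sphere (0 : EuclideanSpace ℝ ι) 1 → ℝ} (hg : Continuous g) :
    Integrable g (sphereUniform ι) := by
  have : CompactSpace (Metric.sphere (0 : EuclideanSpace ℝ ι) 1) :=
    isCompact_iff_compactSpace.mp (isCompact_sphere _ _)
  exact hg.integrable_of_hasCompactSupport (HasCompactSupport.of_compactSpace _)

lemma integral_inner_pow_eq_of_norm_eq {u v : EuclideanSpace ℝ ι} (h : ‖u‖ = ‖v‖) (k : ℕ) :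
    ∫ c, (inner ℝ u (c : EuclideanSpace ℝ ι)) ^ k ∂(sphereUniform ι) =
      ∫ c, (inner ℝ v (c : EuclideanSpace ℝ ι)) ^ k ∂(sphereUniform ι) := by
  set R := (ℝ ∙ (u - v))ᗮ.reflection
  have hR : R u = v := Submodule.reflection_sub h
  conv_rhs => rw [← map_sphereMap_sphereUniform R]
  rw [integral_map (continuous_sphereMap R).aemeasurable
    (by
      have : Continuous fun c : Metric.sphere (0 : EuclideanSpace ℝ ι) 1 =>
        (inner ℝ v (c : EuclideanSpace ℝ ι)) ^ k := by fun_prop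
      exact this.aestronglyMeasurable)]
  simp only [sphereMap, ← hR, LinearIsometryEquiv.inner_map_map]

lemma exists_integral_inner_pow_four [Nonempty ι] : ∃ K : ℝ, ∀ u : EuclideanSpace ℝ ι,
    ∫ c, (inner ℝ u (c : EuclideanSpace ℝ ι)) ^ 4 ∂(sphereUniform ι) = K * (inner ℝ u u) ^ 2 := by
  obtain ⟨e, he⟩ := exists_norm_eq (EuclideanSpace ℝ ι) zero_le_one
  refine ⟨∫ c, (inner ℝ e (c : EuclideanSpace ℝ ι)) ^ 4 ∂(sphereUniform ι), fun u => ?_⟩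
  rw [integral_inner_pow_eq_of_norm_eq (v := ‖u‖ • e) (by simp [norm_smul, he])]
  simp only [inner_smul_left, mul_pow, integral_const_mul, real_inner_self_eq_norm_sq]
  simp
  ring

lemma exists_integral_inner_mul [Nonempty ι] : ∃ K : ℝ, ∀ p q r s : EuclideanSpace ℝ ι,
    ∫ c, inner ℝ p (c : EuclideanSpace ℝ ι) * inner ℝ q (c : EuclideanSpace ℝ ι) *
      inner ℝ r (c : EuclideanSpace ℝ ι) * inner ℝ s (c : EuclideanSpace ℝ ι)
      ∂(sphereUniform ι) =
    K * (inner ℝ p q * inner ℝ r s + inner ℝ p r * inner ℝ q s + inner ℝ p s * inner ℝ q r) := by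
  obtain ⟨K, hK⟩ := exists_integral_inner_pow_four (ι := ι)
  refine ⟨K / 3, fun p q r s => ?_⟩
  have hi : ∀ u : EuclideanSpace ℝ ι, Integrable
      (fun c : Metric.sphere (0 : EuclideanSpace ℝ ι) 1 =>
        (inner ℝ u (c : EuclideanSpace ℝ ι)) ^ 4) (sphereUniform ι) := fun u =>
    integrable_sphereUniform (by fun_prop)
  have hpol : ∀ c : Metric.sphere (0 : EuclideanSpace ℝ ι) 1,
      inner ℝ p (c : EuclideanSpace ℝ ι) * inner ℝ q (c : EuclideanSpace ℝ ι) *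
      inner ℝ r (c : EuclideanSpace ℝ ι) * inner ℝ s (c : EuclideanSpace ℝ ι) =
      (1 / 192) * ((inner ℝ (p + q + r + s) (c : EuclideanSpace ℝ ι)) ^ 4
        - (inner ℝ (p + q + r - s) (c : EuclideanSpace ℝ ι)) ^ 4
        - (inner ℝ (p + q - r + s) (c : EuclideanSpace ℝ ι)) ^ 4
        + (inner ℝ (p + q - r - s) (c : EuclideanSpace ℝ ι)) ^ 4
        - (inner ℝ (p - q + r + s) (c : EuclideanSpace ℝ ι)) ^ 4
        + (inner ℝ (p - q + r - s) (c : EuclideanSpace ℝ ι)) ^ 4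
        + (inner ℝ (p - q - r + s) (c : EuclideanSpace ℝ ι)) ^ 4
        - (inner ℝ (p - q - r - s) (c : EuclideanSpace ℝ ι)) ^ 4) := by
    intro c
    simp only [inner_add_left, inner_sub_left]
    ring
  simp_rw [hpol]
  rw [integral_const_mul, integral_sub (by fun_prop) (hi _), integral_add (by fun_prop) (hi _),
    integral_add (by fun_prop) (hi _), integral_sub (by fun_prop) (hi _),
    integral_add (by fun_prop) (hi _), integral_sub (by fun_prop) (hi _),
    integral_sub (hi _) (hi _)]
  simp only [hK]
  simp only [inner_add_left, inner_sub_left, inner_add_right, inner_sub_right]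
  rw [real_inner_comm p q, real_inner_comm p r, real_inner_comm p s, real_inner_comm q r,
    real_inner_comm q s, real_inner_comm r s]
  ring

/-- The fourth moments of the coordinates of a uniform random point of the unit sphere. -/
lemma integral_coord_mul [Nonempty ι] [DecidableEq ι] (i j k l : ι) :
    ∫ c, (c : EuclideanSpace ℝ ι) i * (c : EuclideanSpace ℝ ι) j *
      (c : EuclideanSpace ℝ ι) k * (c : EuclideanSpace ℝ ι) l ∂(sphereUniform ι) =
    1 / ((Fintype.card ι : ℝ) * (Fintype.card ι + 2)) *
      ((if i = j then 1 else 0) * (if k = l then 1 else 0) +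
        (if i = k then 1 else 0) * (if j = l then 1 else 0) +
        (if i = l then 1 else 0) * (if j = k then 1 else 0)) := by
  obtain ⟨K, hK⟩ := exists_integral_inner_mul (ι := ι)
  have key : ∀ i j k l : ι, ∫ c, (c : EuclideanSpace ℝ ι) i * (c : EuclideanSpace ℝ ι) j *
      (c : EuclideanSpace ℝ ι) k * (c : EuclideanSpace ℝ ι) l ∂(sphereUniform ι) =
      K * ((if i = j then 1 else 0) * (if k = l then 1 else 0) +
        (if i = k then 1 else 0) * (if j = l then 1 else 0) +
        (if i = l then 1 else 0) * (if j = k then 1 else 0)) := by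
    intro i j k l
    have := hK (EuclideanSpace.single i 1) (EuclideanSpace.single j 1)
      (EuclideanSpace.single k 1) (EuclideanSpace.single l 1)
    simpa [EuclideanSpace.inner_single_left, Pi.single_apply] using this
  have hone : ∑ i : ι, ∑ j : ι, ∫ c, (c : EuclideanSpace ℝ ι) i * (c : EuclideanSpace ℝ ι) i *
      (c : EuclideanSpace ℝ ι) j * (c : EuclideanSpace ℝ ι) j ∂(sphereUniform ι) = 1 := by
    have hc : ∀ i j : ι, Integrable (fun c : Metric.sphere (0 : EuclideanSpace ℝ ι) 1 =>
        (c : EuclideanSpace ℝ ι) i * (c : EuclideanSpace ℝ ι) i *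
        (c : EuclideanSpace ℝ ι) j * (c : EuclideanSpace ℝ ι) j) (sphereUniform ι) :=
      fun i j => integrable_sphereUniform (by fun_prop)
    simp_rw [← integral_finsetSum _ fun j _ => hc _ j]
    rw [← integral_finsetSum _ fun i _ => integrable_finsetSum _ fun j _ => hc i j]
    have : ∀ c : Metric.sphere (0 : EuclideanSpace ℝ ι) 1,
        ∑ i, ∑ j, (c : EuclideanSpace ℝ ι) i * (c : EuclideanSpace ℝ ι) i *
        (c : EuclideanSpace ℝ ι) j * (c : EuclideanSpace ℝ ι) j = 1 := by
      intro c
      have h1 : ∑ i, (c : EuclideanSpace ℝ ι) i * (c : EuclideanSpace ℝ ι) i = 1 := by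
        have := EuclideanSpace.real_norm_sq_eq (c : EuclideanSpace ℝ ι)
        rw [norm_eq_of_mem_sphere] at this
        simpa [sq] using this.symm
      calc _ = (∑ i, (c : EuclideanSpace ℝ ι) i * (c : EuclideanSpace ℝ ι) i) *
            ∑ j, (c : EuclideanSpace ℝ ι) j * (c : EuclideanSpace ℝ ι) j := by
              simp only [Finset.sum_mul_sum, mul_assoc]
        _ = 1 := by rw [h1, mul_one]
    simp [this]
  rw [key]
  congr 1
  have hN : (0 : ℝ) < Fintype.card ι := by exact_mod_cast Fintype.card_pos
  simp_rw [key] at hone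
  simp [← Finset.mul_sum, Finset.sum_add_distrib] at hone
  rw [eq_div_iff (by positivity)]
  linarith

end SphereMoments

section TorusIntegrals

variable {n : ℕ}

instance isProbabilityMeasure_torusMeasure : IsProbabilityMeasure (torusMeasure n) := by
  constructor
  rw [torusMeasure, Measure.restrict_apply_univ, volume_pi_pi]
  simp

lemma integrable_torusMeasure {g : (Fin n → ℝ) → ℝ} (hg : Continuous g) :
    Integrable g (torusMeasure n) := by
  have : IntegrableOn g (Set.univ.pi fun _ => Set.Icc (0 : ℝ) 1) :=
    hg.continuousOn.integrableOn_compact (isCompact_univ_pi fun _ => isCompact_Icc)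
  exact this.mono_set (Set.pi_mono fun _ _ => Set.Ico_subset_Icc_self)

lemma integral_Ico_exp_int {m : ℤ} (hm : m ≠ 0) :
    ∫ x in Set.Ico (0 : ℝ) 1, Complex.exp (2 * π * Complex.I * m * x) = 0 := by
  have hc : 2 * π * Complex.I * m ≠ 0 := by simp [hm, Complex.I_ne_zero, Real.pi_ne_zero]
  rw [integral_Ico_eq_integral_Ioc, ← intervalIntegral.integral_of_le zero_le_one,
    integral_exp_mul_complex hc]
  have : Complex.exp (2 * π * Complex.I * m) = 1 :=
    Complex.exp_eq_one_iff.mpr ⟨m, by ring⟩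
  simp [this]

/-- Nontrivial characters have mean zero on the torus. -/
lemma integral_cos_torusMeasure {u : Fin n → ℝ} (hu : ∀ j, ∃ m : ℤ, u j = m) (hu0 : u ≠ 0) :
    ∫ x, Real.cos (2 * π * (u ⬝ᵥ x)) ∂(torusMeasure n) = 0 := by
  choose m hm using hu
  obtain ⟨j, hj⟩ := Function.ne_iff.mp hu0
  have hexp : ∫ x, Complex.exp (2 * π * Complex.I * ((u ⬝ᵥ x : ℝ) : ℂ)) ∂(torusMeasure n) = 0 := by
    have : ∀ x : Fin n → ℝ, Complex.exp (2 * π * Complex.I * ((u ⬝ᵥ x : ℝ) : ℂ)) =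
        ∏ j, Complex.exp (2 * π * Complex.I * m j * x j) := by
      intro x
      rw [← Complex.exp_sum]
      simp only [dotProduct, hm, Complex.ofReal_sum, Finset.mul_sum]
      congr 1
      refine Finset.sum_congr rfl fun j _ => ?_
      push_cast
      ring
    simp_rw [this]
    rw [torusMeasure, volume_pi, Measure.restrict_pi_pi, integral_fintype_prod_eq_prod
      (fun j (y : ℝ) => Complex.exp (2 * π * Complex.I * m j * y))]
    refine Finset.prod_eq_zero (Finset.mem_univ j) (integral_Ico_exp_int ?_)
    rintro h
    simp [hm, h] at hj
  have hre : ∀ x : Fin n → ℝ, Real.cos (2 * π * (u ⬝ᵥ x)) =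
      RCLike.re (Complex.exp (2 * π * Complex.I * ((u ⬝ᵥ x : ℝ) : ℂ))) := by
    intro x
    have : 2 * π * Complex.I * ((u ⬝ᵥ x : ℝ) : ℂ) = ((2 * π * (u ⬝ᵥ x) : ℝ) : ℂ) * Complex.I := by
      push_cast; ring
    rw [this]
    exact (Complex.exp_ofReal_mul_I_re _).symm
  simp_rw [hre]
  rw [integral_re, hexp]
  · simp
  · refine (integrable_const (1 : ℝ)).mono' ?_ (ae_of_all _ fun x => ?_)
    · exact Continuous.aestronglyMeasurable (by unfold dotProduct; fun_prop)
    · have : 2 * π * Complex.I * ((u ⬝ᵥ x : ℝ) : ℂ) =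
          ((2 * π * (u ⬝ᵥ x) : ℝ) : ℂ) * Complex.I := by
        push_cast; ring
      rw [this, Complex.norm_exp_ofReal_mul_I]

lemma integral_sin_sq_mul_sin_sq {u w : Fin n → ℝ} (hu : ∀ j, ∃ m : ℤ, u j = m)
    (hw : ∀ j, ∃ m : ℤ, w j = m) (hu0 : u ≠ 0) (hw0 : w ≠ 0) (huw : u + w ≠ 0) :
    ∫ x, Real.sin (2 * π * (u ⬝ᵥ x)) ^ 2 * Real.sin (2 * π * (w ⬝ᵥ x)) ^ 2 ∂(torusMeasure n) =
      1 / 4 + if u = w then 1 / 8 else 0 := by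
  have hid : ∀ x : Fin n → ℝ,
      Real.sin (2 * π * (u ⬝ᵥ x)) ^ 2 * Real.sin (2 * π * (w ⬝ᵥ x)) ^ 2 =
      1 / 4 - 1 / 4 * Real.cos (2 * π * ((u + u) ⬝ᵥ x)) - 1 / 4 * Real.cos (2 * π * ((w + w) ⬝ᵥ x))
        + 1 / 8 * Real.cos (2 * π * ((u + w + (u + w)) ⬝ᵥ x))
        + 1 / 8 * Real.cos (2 * π * ((u - w + (u - w)) ⬝ᵥ x)) := by
    intro x
    simp only [add_dotProduct, sub_dotProduct]
    generalize u ⬝ᵥ x = p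
    generalize w ⬝ᵥ x = q
    have e1 : 2 * π * (p + p) = 2 * (2 * π * p) := by ring
    have e2 : 2 * π * (q + q) = 2 * (2 * π * q) := by ring
    have e3 : 2 * π * (p + q + (p + q)) = 2 * (2 * π * p) + 2 * (2 * π * q) := by ring
    have e4 : 2 * π * (p - q + (p - q)) = 2 * (2 * π * p) - 2 * (2 * π * q) := by ring
    rw [e1, e2, e3, e4, Real.cos_add, Real.cos_sub, Real.cos_two_mul, Real.cos_two_mul,
      Real.sin_sq, Real.sin_sq]
    ring
  have hint : ∀ (r : ℝ) (u : Fin n → ℝ),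
      Integrable (fun x => r * Real.cos (2 * π * (u ⬝ᵥ x))) (torusMeasure n) := fun r u =>
    integrable_torusMeasure (by unfold dotProduct; fun_prop)
  have hadd : ∀ {a b : Fin n → ℝ}, (∀ j, ∃ m : ℤ, a j = m) → (∀ j, ∃ m : ℤ, b j = m) →
      ∀ j, ∃ m : ℤ, (a + b) j = m := fun ha hb j => by
    obtain ⟨k, hk⟩ := ha j
    obtain ⟨l, hl⟩ := hb j
    exact ⟨k + l, by simp [hk, hl]⟩
  have hsub : ∀ j, ∃ m : ℤ, (u - w) j = m := fun j => by
    obtain ⟨k, hk⟩ := hu j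
    obtain ⟨l, hl⟩ := hw j
    exact ⟨k - l, by simp [hk, hl]⟩
  have hne : ∀ {a : Fin n → ℝ}, a ≠ 0 → a + a ≠ 0 := fun ha h => ha (by
    rw [← two_smul ℝ] at h
    simpa using h)
  simp_rw [hid]
  rw [integral_add (by fun_prop) (hint _ _), integral_add (by fun_prop) (hint _ _),
    integral_sub (by fun_prop) (hint _ _), integral_sub (by fun_prop) (hint _ _)]
  simp only [integral_const_mul]
  rw [integral_cos_torusMeasure (hadd hu hu) (hne hu0),
    integral_cos_torusMeasure (hadd hw hw) (hne hw0),
    integral_cos_torusMeasure (hadd (hadd hu hw) (hadd hu hw)) (hne huw)]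
  split_ifs with h
  · simp [h]
  · rw [integral_cos_torusMeasure (hadd hsub hsub) (hne (sub_ne_zero.mpr h))]
    simp

end TorusIntegrals

section Gradient

variable {n : ℕ}

lemma gradB_eq (B : Matrix (Fin n) (Fin n) ℝ) (𝒱 : Finset (Fin n → ℝ))
    (a : ↥𝒱 → ℝ) (x : Fin n → ℝ) :
    gradB B 𝒱 a x =
      ∑ v : ↥𝒱, (-(2 * π * a v * Real.sin (2 * π * (B.mulVec v ⬝ᵥ x)))) • (v : Fin n → ℝ) := by
  ext k
  simp only [gradB, Complex.im_sum, Finset.sum_apply, Pi.smul_apply, smul_eq_mul,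
    ← Finset.sum_neg_distrib]
  refine Finset.sum_congr rfl fun v _ => ?_
  have h1 : 2 * π * Complex.I * ((B.mulVec v ⬝ᵥ x : ℝ) : ℂ) =
      ((2 * π * (B.mulVec v ⬝ᵥ x) : ℝ) : ℂ) * Complex.I := by
    push_cast; ring
  have h2 : (2 * π * (a v : ℂ)) = ((2 * π * a v : ℝ) : ℂ) := by push_cast; ring
  rw [h1, h2, Complex.im_mul_ofReal, Complex.im_ofReal_mul, Complex.exp_ofReal_mul_I_im]
  ring

lemma normBsq_gradB_sq (B : Matrix (Fin n) (Fin n) ℝ) (𝒱 : Finset (Fin n → ℝ))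
    (a : ↥𝒱 → ℝ) (x : Fin n → ℝ) :
    normBsq B (gradB B 𝒱 a x) ^ 2 =
      ∑ v : ↥𝒱, ∑ w : ↥𝒱, ∑ u : ↥𝒱, ∑ t : ↥𝒱, a v * a w * a u * a t *
        (16 * π ^ 4 * (B.mulVec v ⬝ᵥ (w : Fin n → ℝ)) * (B.mulVec u ⬝ᵥ (t : Fin n → ℝ)) *
        (Real.sin (2 * π * (B.mulVec v ⬝ᵥ x)) * Real.sin (2 * π * (B.mulVec w ⬝ᵥ x)) *
          Real.sin (2 * π * (B.mulVec u ⬝ᵥ x)) * Real.sin (2 * π * (B.mulVec t ⬝ᵥ x)))) := by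
  have h : normBsq B (gradB B 𝒱 a x) = ∑ v : ↥𝒱, ∑ w : ↥𝒱, 4 * π ^ 2 * (a v * a w *
      (B.mulVec v ⬝ᵥ (w : Fin n → ℝ)) *
      (Real.sin (2 * π * (B.mulVec v ⬝ᵥ x)) * Real.sin (2 * π * (B.mulVec w ⬝ᵥ x)))) := by
    rw [normBsq, gradB_eq, Matrix.mulVec_sum, sum_dotProduct]
    refine Finset.sum_congr rfl fun v _ => ?_
    rw [dotProduct_sum]
    refine Finset.sum_congr rfl fun w _ => ?_
    rw [Matrix.mulVec_smul, smul_dotProduct, dotProduct_smul, smul_eq_mul, smul_eq_mul]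
    ring
  rw [h, sq, Finset.sum_mul]
  refine Finset.sum_congr rfl fun v _ => ?_
  rw [Finset.sum_mul]
  refine Finset.sum_congr rfl fun w _ => ?_
  rw [Finset.mul_sum]
  refine Finset.sum_congr rfl fun u _ => ?_
  rw [Finset.mul_sum]
  refine Finset.sum_congr rfl fun t _ => ?_
  ring

/-- The fourth moments of the coefficients. -/
lemma integral_coeffMeasure_mul {𝒱 : Finset (Fin n → ℝ)} (h𝒱 : 𝒱.Nonempty) (v w u t : ↥𝒱) :
    ∫ a, a v * a w * a u * a t ∂(coeffMeasure 𝒱) =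
      4 / ((𝒱.card : ℝ) * (𝒱.card + 2)) *
      ((if v = w then 1 else 0) * (if u = t then 1 else 0) +
        (if v = u then 1 else 0) * (if w = t then 1 else 0) +
        (if v = t then 1 else 0) * (if w = u then 1 else 0)) := by
  have : Nonempty ↥𝒱 := h𝒱.to_subtype
  rw [coeffMeasure, integral_map
    (Continuous.aemeasurable (by fun_prop)) (Continuous.aestronglyMeasurable (by fun_prop))]
  have hs : Real.sqrt 2 ^ 4 = 4 := by
    rw [show (4 : ℕ) = 2 * 2 from rfl, pow_mul, Real.sq_sqrt zero_le_two]; norm_num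
  have : ∀ c : Metric.sphere (0 : EuclideanSpace ℝ ↥𝒱) 1,
      Real.sqrt 2 * (c : EuclideanSpace ℝ ↥𝒱) v * (Real.sqrt 2 * (c : EuclideanSpace ℝ ↥𝒱) w) *
      (Real.sqrt 2 * (c : EuclideanSpace ℝ ↥𝒱) u) * (Real.sqrt 2 * (c : EuclideanSpace ℝ ↥𝒱) t) =
      4 * ((c : EuclideanSpace ℝ ↥𝒱) v * (c : EuclideanSpace ℝ ↥𝒱) w *
        (c : EuclideanSpace ℝ ↥𝒱) u * (c : EuclideanSpace ℝ ↥𝒱) t) := by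
    intro c
    rw [← hs]; ring
  simp_rw [this]
  rw [integral_const_mul, integral_coord_mul, Fintype.card_coe]
  ring

lemma integrable_coeffMeasure {𝒱 : Finset (Fin n → ℝ)} (h𝒱 : 𝒱.Nonempty) {g : (↥𝒱 → ℝ) → ℝ}
    (hg : Continuous g) : Integrable g (coeffMeasure 𝒱) := by
  have : Nonempty ↥𝒱 := h𝒱.to_subtype
  rw [coeffMeasure, integrable_map_measure hg.aestronglyMeasurable
    (Continuous.aemeasurable (by fun_prop))]
  exact integrable_sphereUniform (hg.comp (by fun_prop))

end Gradient

theorem stmt18 (n : ℕ) (B : Matrix (Fin n) (Fin n) ℝ)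
    (hBsymm : B.IsSymm) (hBpos : B.PosDef)
    (𝒱 : Finset (Fin n → ℝ)) (h𝒱 : 𝒱.Nonempty)
    (hint : ∀ v ∈ 𝒱, ∀ j, ∃ m : ℤ, B.mulVec v j = (m : ℝ))
    (hne : ∀ v ∈ 𝒱, ∀ w ∈ 𝒱, v + w ≠ 0) :
    (∫ a, ∫ x, (normBsq B (gradB B 𝒱 a x)) ^ 2 ∂(torusMeasure n) ∂(coeffMeasure 𝒱))
      = (8 * π ^ 4 / ((𝒱.card : ℝ) * ((𝒱.card : ℝ) + 2))) *
        (3 * ∑ v ∈ 𝒱, (normBsq B v) ^ 2 + 2 * (∑ v ∈ 𝒱, normBsq B v) ^ 2 +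
          4 * ∑ v ∈ 𝒱, ∑ w ∈ 𝒱, (B.mulVec v ⬝ᵥ w) ^ 2) := by
  classical
  have hinj : Function.Injective B.mulVec := Matrix.mulVec_injective_of_isUnit hBpos.isUnit
  have hsin : ∀ v w : ↥𝒱, ∫ x, Real.sin (2 * π * (B.mulVec v ⬝ᵥ x)) ^ 2 *
      Real.sin (2 * π * (B.mulVec w ⬝ᵥ x)) ^ 2 ∂(torusMeasure n) =
      1 / 4 + if v = w then 1 / 8 else 0 := by
    intro v w
    have hadd : ∀ v w : ↥𝒱, B.mulVec v + B.mulVec w ≠ 0 := fun v w h => by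
      rw [← Matrix.mulVec_add] at h
      exact hne v v.2 w w.2 (hinj (by rw [h, Matrix.mulVec_zero]))
    have h0 : ∀ v : ↥𝒱, B.mulVec v ≠ 0 := fun v h => hadd v v (by simp [h])
    rw [integral_sin_sq_mul_sin_sq (hint v v.2) (hint w w.2) (h0 v) (h0 w) (hadd v w)]
    simp only [hinj.eq_iff, Subtype.ext_iff]
  set G : ↥𝒱 → ↥𝒱 → ℝ := fun v w => B.mulVec v ⬝ᵥ (w : Fin n → ℝ) with hG
  have hGsymm : ∀ v w, G v w = G w v := fun v w => by
    rw [hG]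
    simp only
    rw [dotProduct_comm, Matrix.dotProduct_mulVec, ← Matrix.mulVec_transpose, hBsymm.eq]
  set S : ↥𝒱 → ↥𝒱 → ↥𝒱 → ↥𝒱 → ℝ := fun v w u t => ∫ x,
      Real.sin (2 * π * (B.mulVec v ⬝ᵥ x)) * Real.sin (2 * π * (B.mulVec w ⬝ᵥ x)) *
      Real.sin (2 * π * (B.mulVec u ⬝ᵥ x)) * Real.sin (2 * π * (B.mulVec t ⬝ᵥ x))
      ∂(torusMeasure n) with hS
  have hS1 : ∀ v u, S v v u u = 1 / 4 + if v = u then 1 / 8 else 0 := fun v u => by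
    rw [← hsin, hS]
    simp only
    congr 1; ext x; ring
  have hS2 : ∀ v u, S v u v u = 1 / 4 + if v = u then 1 / 8 else 0 := fun v u => by
    rw [← hsin, hS]
    simp only
    congr 1; ext x; ring
  have hS3 : ∀ v u, S v u u v = 1 / 4 + if v = u then 1 / 8 else 0 := fun v u => by
    rw [← hsin, hS]
    simp only
    congr 1; ext x; ring
  have hinner : ∀ a : ↥𝒱 → ℝ, ∫ x, (normBsq B (gradB B 𝒱 a x)) ^ 2 ∂(torusMeasure n) =
      ∑ v, ∑ w, ∑ u, ∑ t, a v * a w * a u * a t * (16 * π ^ 4 * G v w * G u t * S v w u t) := by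
    intro a
    simp_rw [normBsq_gradB_sq]
    have hi : ∀ v w u t : ↥𝒱, Integrable (fun x => a v * a w * a u * a t *
        (16 * π ^ 4 * (B.mulVec v ⬝ᵥ (w : Fin n → ℝ)) * (B.mulVec u ⬝ᵥ (t : Fin n → ℝ)) *
        (Real.sin (2 * π * (B.mulVec v ⬝ᵥ x)) * Real.sin (2 * π * (B.mulVec w ⬝ᵥ x)) *
          Real.sin (2 * π * (B.mulVec u ⬝ᵥ x)) * Real.sin (2 * π * (B.mulVec t ⬝ᵥ x)))))
        (torusMeasure n) := fun v w u t =>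
      integrable_torusMeasure (by unfold dotProduct; fun_prop)
    rw [integral_finsetSum _ fun v _ => integrable_finsetSum _ fun w _ =>
      integrable_finsetSum _ fun u _ => integrable_finsetSum _ fun t _ => hi v w u t]
    refine Finset.sum_congr rfl fun v _ => ?_
    rw [integral_finsetSum _ fun w _ =>
      integrable_finsetSum _ fun u _ => integrable_finsetSum _ fun t _ => hi v w u t]
    refine Finset.sum_congr rfl fun w _ => ?_
    rw [integral_finsetSum _ fun u _ => integrable_finsetSum _ fun t _ => hi v w u t]
    refine Finset.sum_congr rfl fun u _ => ?_
    rw [integral_finsetSum _ fun t _ => hi v w u t]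
    refine Finset.sum_congr rfl fun t _ => ?_
    rw [integral_const_mul, integral_const_mul]
  have houter : ∫ a, ∑ v, ∑ w, ∑ u, ∑ t,
      a v * a w * a u * a t * (16 * π ^ 4 * G v w * G u t * S v w u t) ∂(coeffMeasure 𝒱) =
      ∑ v, ∑ w, ∑ u, ∑ t, 4 / ((𝒱.card : ℝ) * (𝒱.card + 2)) *
      ((if v = w then 1 else 0) * (if u = t then 1 else 0) +
        (if v = u then 1 else 0) * (if w = t then 1 else 0) +
        (if v = t then 1 else 0) * (if w = u then 1 else 0)) *
        (16 * π ^ 4 * G v w * G u t * S v w u t) := by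
    have hi : ∀ v w u t : ↥𝒱, Integrable (fun a : ↥𝒱 → ℝ => a v * a w * a u * a t *
        (16 * π ^ 4 * G v w * G u t * S v w u t)) (coeffMeasure 𝒱) := fun v w u t =>
      integrable_coeffMeasure h𝒱 (by fun_prop)
    rw [integral_finsetSum _ fun v _ => integrable_finsetSum _ fun w _ =>
      integrable_finsetSum _ fun u _ => integrable_finsetSum _ fun t _ => hi v w u t]
    refine Finset.sum_congr rfl fun v _ => ?_
    rw [integral_finsetSum _ fun w _ =>
      integrable_finsetSum _ fun u _ => integrable_finsetSum _ fun t _ => hi v w u t]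
    refine Finset.sum_congr rfl fun w _ => ?_
    rw [integral_finsetSum _ fun u _ => integrable_finsetSum _ fun t _ => hi v w u t]
    refine Finset.sum_congr rfl fun u _ => ?_
    rw [integral_finsetSum _ fun t _ => hi v w u t]
    refine Finset.sum_congr rfl fun t _ => ?_
    rw [integral_mul_const, integral_coeffMeasure_mul h𝒱]
  simp_rw [hinner]
  rw [houter]
  have hcollapse : ∀ F : ↥𝒱 → ↥𝒱 → ↥𝒱 → ↥𝒱 → ℝ, ∑ v, ∑ w, ∑ u, ∑ t,
      ((if v = w then 1 else 0) * (if u = t then 1 else 0) +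
        (if v = u then 1 else 0) * (if w = t then 1 else 0) +
        (if v = t then 1 else 0) * (if w = u then 1 else 0)) * F v w u t =
      ∑ v, ∑ w, (F v v w w + F v w v w + F v w w v) := by
    intro F
    simp [add_mul, Finset.sum_add_distrib, ite_mul]
  have hterm : ∀ v w, 16 * π ^ 4 * G v v * G w w * S v v w w +
      16 * π ^ 4 * G v w * G v w * S v w v w + 16 * π ^ 4 * G v w * G w v * S v w w v =
      2 * π ^ 4 * (2 * (G v v * G w w) + 4 * G v w ^ 2 + if v = w then 3 * G v v ^ 2 else 0) := by
    intro v w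
    rw [hS1, hS2, hS3, hGsymm w v]
    split_ifs with h
    · subst h; ring
    · ring
  simp_rw [mul_assoc (4 / ((𝒱.card : ℝ) * (𝒱.card + 2))), ← Finset.mul_sum]
  rw [hcollapse]
  simp_rw [hterm, ← Finset.mul_sum, Finset.sum_add_distrib, Finset.sum_ite_eq, Finset.mem_univ,
    if_true, ← Finset.mul_sum, ← Finset.sum_mul]
  rw [← Finset.sum_coe_sort 𝒱 (fun v => normBsq B v ^ 2), ← Finset.sum_coe_sort 𝒱 (normBsq B),
    ← Finset.sum_coe_sort 𝒱 (fun v => ∑ w ∈ 𝒱, (B.mulVec v ⬝ᵥ w) ^ 2)]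
  simp_rw [← Finset.sum_coe_sort 𝒱 (fun w => (B.mulVec _ ⬝ᵥ w) ^ 2)]
  simp only [hG, normBsq]
  ring

end
end

section
/- Let {a_v}_{v∈𝒱} be a uniform random point of the sphere of radius √2 in ℝ^𝒱 and let f(x) = Re(Σ_{v∈𝒱} a_v e^{2πi⟨Bv,x⟩}). Then 𝔼_a[ ( ∫_{𝕋^n} ‖∇_B f(x)‖_B² dx )² ] = ((2π)⁴/(|𝒱|(|𝒱|+2))) · [ (Σ_{v∈𝒱} ‖v‖_B²)² + 2 Σ_{v∈𝒱} ‖v‖_B⁴ ], where the inner integral is with respect to the uniform probability measure on 𝕋^n and the outer expectation is over the coefficients. -/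
open MeasureTheory ProbabilityTheory Real Finset Matrix

theorem integral_Ioi_pow_mul_exp_neg_sq (m : ℕ) :
    ∫ x in Set.Ioi (0 : ℝ), x ^ m * Real.exp (-x ^ 2) = 1 / 2 * Real.Gamma ((m + 1) / 2) := by
  have h := integral_rpow_mul_exp_neg_rpow (p := 2) (q := m) two_pos
    (by have := Nat.cast_nonneg (α := ℝ) m; linarith)
  simpa [Real.rpow_natCast] using h

theorem integral_even_pow_mul_exp_neg_sq (j : ℕ) :
    ∫ x : ℝ, x ^ (2 * j) * Real.exp (-x ^ 2) = Real.Gamma (j + 1 / 2) := by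
  have h := integral_comp_abs (f := fun x : ℝ => x ^ (2 * j) * Real.exp (-x ^ 2))
  simp only [pow_mul, sq_abs] at h
  simp only [← pow_mul] at h
  rw [h, integral_Ioi_pow_mul_exp_neg_sq]
  push_cast
  rw [show ((2 * j + 1) / 2 : ℝ) = j + 1 / 2 by ring]
  ring

/-- Integration in polar coordinates of a homogeneous function against a Gaussian weight. -/
theorem integral_homogeneous_mul_exp_neg_norm_sq {E : Type*} [NormedAddCommGroup E]
    [NormedSpace ℝ E] [MeasurableSpace E] [BorelSpace E] [FiniteDimensional ℝ E] [Nontrivial E]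
    (μ : Measure E) [μ.IsAddHaarMeasure] (d : ℕ) (g : E → ℝ)
    (hg : ∀ (r : ℝ) (x : E), g (r • x) = r ^ d * g x) :
    ∫ x, g x * Real.exp (-‖x‖ ^ 2) ∂μ =
      (∫ c : Metric.sphere (0 : E) 1, g c ∂μ.toSphere) *
        (1 / 2 * Real.Gamma ((Module.finrank ℝ E + d) / 2)) := by
  have hpos : 0 < Module.finrank ℝ E := Module.finrank_pos
  calc
    ∫ x, g x * Real.exp (-‖x‖ ^ 2) ∂μ
        = ∫ x : ({(0)}ᶜ : Set E), g x.1 * Real.exp (-‖x.1‖ ^ 2) ∂(μ.comap (↑)) := by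
      rw [integral_subtype_comap (measurableSet_singleton _).compl
        fun x ↦ g x * Real.exp (-‖x‖ ^ 2), restrict_compl_singleton]
    _ = ∫ p : Metric.sphere (0 : E) 1 × Set.Ioi (0 : ℝ),
          g p.1 * ((p.2 : ℝ) ^ d * Real.exp (-(p.2 : ℝ) ^ 2))
          ∂μ.toSphere.prod (.volumeIoiPow (Module.finrank ℝ E - 1)) := by
      rw [← μ.measurePreserving_homeomorphUnitSphereProd.integral_comp
        (Homeomorph.measurableEmbedding _)]
      refine integral_congr_ae (.of_forall fun x => ?_)
      have hx : ‖x.1‖ ≠ 0 := norm_ne_zero_iff.2 x.2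
      have h := hg ‖x.1‖ (‖x.1‖⁻¹ • x.1)
      rw [smul_inv_smul₀ hx] at h
      simp only [homeomorphUnitSphereProd_apply_snd_coe, homeomorphUnitSphereProd_apply_fst_coe]
      rw [h]
      ring
    _ = (∫ c : Metric.sphere (0 : E) 1, g c ∂μ.toSphere) *
          ∫ r : Set.Ioi (0 : ℝ), (r : ℝ) ^ d * Real.exp (-(r : ℝ) ^ 2)
            ∂.volumeIoiPow (Module.finrank ℝ E - 1) :=
      integral_prod_mul (fun c : Metric.sphere (0 : E) 1 => g c)
        (fun r : Set.Ioi (0 : ℝ) => (r : ℝ) ^ d * Real.exp (-(r : ℝ) ^ 2))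
    _ = _ := by
      congr 1
      simp only [Measure.volumeIoiPow, ENNReal.ofReal]
      rw [integral_withDensity_eq_integral_smul,
        integral_subtype_comap measurableSet_Ioi fun a : ℝ ↦
          Real.toNNReal (a ^ (Module.finrank ℝ E - 1)) • (a ^ d * Real.exp (-a ^ 2)),
        setIntegral_congr_fun (g := fun a : ℝ => a ^ (Module.finrank ℝ E - 1 + d) *
          Real.exp (-a ^ 2)) measurableSet_Ioi fun x hx ↦ ?_]
      · rw [integral_Ioi_pow_mul_exp_neg_sq]
        push_cast [Nat.cast_sub hpos]
        ring_nf
      · simp only [NNReal.smul_def, smul_eq_mul]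
        rw [Real.coe_toNNReal _ (pow_nonneg (le_of_lt hx) _)]
        ring
      · exact (measurable_subtype_coe.pow_const _).real_toNNReal

/-- The Gaussian integral of a monomial with even exponents. -/
theorem integral_prod_even_pow_mul_exp_neg_norm_sq {ι : Type*} [Fintype ι] (j : ι → ℕ) :
    ∫ x : EuclideanSpace ℝ ι, (∏ i, x i ^ (2 * j i)) * Real.exp (-‖x‖ ^ 2) =
      ∏ i, Real.Gamma (j i + 1 / 2) := by
  rw [← (PiLp.volume_preserving_toLp ι).integral_comp
    (MeasurableEquiv.toLp 2 (ι → ℝ)).measurableEmbedding]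
  simp_rw [EuclideanSpace.norm_sq_eq, ← Finset.sum_neg_distrib, Real.exp_sum,
    ← Finset.prod_mul_distrib, Real.norm_eq_abs, sq_abs]
  rw [integral_fintype_prod_volume_eq_prod
    (fun i (x : ℝ) => x ^ (2 * j i) * Real.exp (-x ^ 2))]
  exact Finset.prod_congr rfl fun i _ => integral_even_pow_mul_exp_neg_sq (j i)

/-- The uniform fourth moments of the coordinates of a point on the unit sphere. -/
theorem integral_sphereUniform_sq_mul_sq {ι : Type*} [Fintype ι] [DecidableEq ι] (v w : ι) :
    ∫ c, ((c : EuclideanSpace ℝ ι) v) ^ 2 * ((c : EuclideanSpace ℝ ι) w) ^ 2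
        ∂(sphereUniform ι) =
      (if v = w then 3 else 1) / ((Fintype.card ι : ℝ) * (Fintype.card ι + 2)) := by
  have : Nonempty ι := ⟨v⟩
  have hN : (0 : ℝ) < Fintype.card ι := Nat.cast_pos.2 Fintype.card_pos
  set S := (volume : Measure (EuclideanSpace ℝ ι)).toSphere with hS
  have hmono : ∀ x : EuclideanSpace ℝ ι, x v ^ 2 * x w ^ 2 =
      ∏ i, x i ^ (2 * ((if i = v then 1 else 0) + (if i = w then 1 else 0))) := by
    intro x
    simp_rw [mul_add, pow_add, Finset.prod_mul_distrib, mul_ite, pow_ite]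
    simp
  have h4 := integral_homogeneous_mul_exp_neg_norm_sq
    (volume : Measure (EuclideanSpace ℝ ι)) 4 (fun x => x v ^ 2 * x w ^ 2)
    (fun r x => by simp; ring)
  have h0 := integral_homogeneous_mul_exp_neg_norm_sq
    (volume : Measure (EuclideanSpace ℝ ι)) 0 (fun _ => 1) (fun r x => by simp)
  have g4 : ∫ x : EuclideanSpace ℝ ι, (x v ^ 2 * x w ^ 2) * Real.exp (-‖x‖ ^ 2) =
      (if v = w then 3 else 1) / 4 * ∏ _i : ι, Real.Gamma (1 / 2) := by
    simp_rw [hmono]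
    rw [integral_prod_even_pow_mul_exp_neg_norm_sq]
    have h1 : Real.Gamma (1 + 1 / 2) = 1 / 2 * Real.Gamma (1 / 2) := by
      rw [add_comm, Real.Gamma_add_one (by norm_num)]
    have h2 : Real.Gamma (2 + 1 / 2) = 3 / 4 * Real.Gamma (1 / 2) := by
      rw [show (2 + 1 / 2 : ℝ) = (1 + 1 / 2) + 1 by norm_num, Real.Gamma_add_one (by norm_num), h1]
      ring
    have key : ∀ i : ι, Real.Gamma
        ((((if i = v then 1 else 0) + (if i = w then 1 else 0) : ℕ) : ℝ) + 1 / 2) =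
        (if i = v then (if v = w then 3 / 4 else 1 / 2) else 1) *
          (if i = w then (if v = w then 1 else 1 / 2) else 1) * Real.Gamma (1 / 2) := by
      intro i
      by_cases hv : i = v <;> by_cases hw : i = w
      · subst hv; subst hw
        simp only [if_true, mul_one, ← h2]
        norm_num
      · subst hv; simpa [hw] using h1
      · subst hw; simpa [hv, Ne.symm hv] using h1
      · simp [hv, hw]
    simp_rw [key, Finset.prod_mul_distrib]
    simp only [Finset.prod_ite_eq', Finset.mem_univ, if_true]
    split_ifs <;> ring
  have g0 : ∫ x : EuclideanSpace ℝ ι, 1 * Real.exp (-‖x‖ ^ 2) =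
      ∏ _i : ι, Real.Gamma (1 / 2) := by
    simpa using integral_prod_even_pow_mul_exp_neg_norm_sq (fun _ : ι => 0)
  have hP : (0 : ℝ) < ∏ _i : ι, Real.Gamma (1 / 2) :=
    Finset.prod_pos fun _ _ => Real.Gamma_pos_of_pos (by norm_num)
  rw [g4] at h4
  rw [g0] at h0
  have hΓ : Real.Gamma ((Fintype.card ι + 4) / 2) =
      (Fintype.card ι + 2) / 2 * (Fintype.card ι / 2 * Real.Gamma (Fintype.card ι / 2)) := by
    rw [← Real.Gamma_add_one (by positivity),
      show (Fintype.card ι / 2 + 1 : ℝ) = (Fintype.card ι + 2) / 2 by ring,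
      ← Real.Gamma_add_one (by positivity)]
    congr 1; ring
  have hG : 0 < Real.Gamma (Fintype.card ι / 2) := Real.Gamma_pos_of_pos (by positivity)
  simp only [finrank_euclideanSpace, integral_const, smul_eq_mul, mul_one, Nat.cast_zero,
    add_zero, Nat.cast_ofNat, ← hS] at h0 h4
  rw [hΓ, h0] at h4
  have hSpos : 0 < S.real Set.univ := by
    rcases (measureReal_nonneg (μ := S) (s := Set.univ)).lt_or_eq with h | h
    · exact h
    · rw [← h, zero_mul] at h0; exact absurd h0 hP.ne'
  rw [sphereUniform, integral_smul_measure, ← hS, ENNReal.toReal_inv, smul_eq_mul]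
  change (S.real Set.univ)⁻¹ * _ = _
  set I := ∫ c : Metric.sphere (0 : EuclideanSpace ℝ ι) 1,
    ((c : EuclideanSpace ℝ ι) v) ^ 2 * ((c : EuclideanSpace ℝ ι) w) ^ 2 ∂S
  rw [inv_mul_eq_div, div_eq_div_iff hSpos.ne' (by positivity)]
  generalize (if v = w then (3 : ℝ) else 1) = q at *
  have := mul_right_cancel₀ hG.ne' (a := q * S.real Set.univ)
    (c := I * (Fintype.card ι * (Fintype.card ι + 2))) (by linear_combination 8 * h4)
  exact this.symm

theorem integral_Ico_exp_int_mul (m : ℤ) :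
    ∫ x in Set.Ico (0 : ℝ) 1, Complex.exp (2 * π * Complex.I * m * x) =
      if m = 0 then 1 else 0 := by
  rw [integral_Ico_eq_integral_Ioc, ← intervalIntegral.integral_of_le zero_le_one]
  split_ifs with h
  · simp [h]
  · rw [integral_exp_mul_complex (by simp [h, Real.pi_ne_zero])]
    have : Complex.exp (2 * π * Complex.I * m * (1 : ℝ)) = 1 := by
      rw [Complex.exp_eq_one_iff]
      exact ⟨m, by push_cast; ring⟩
    rw [this]
    simp

instance isFiniteMeasure_torusMeasure (n : ℕ) : IsFiniteMeasure (torusMeasure n) := by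
  rw [torusMeasure, volume_pi, Measure.restrict_pi_pi]
  infer_instance

theorem integral_torusMeasure_cos {n : ℕ} (m : Fin n → ℝ)
    (hm : ∀ j, ∃ k : ℤ, m j = k) :
    ∫ x, Real.cos (2 * π * (m ⬝ᵥ x)) ∂(torusMeasure n) = if m = 0 then 1 else 0 := by
  choose k hk using hm
  have hmk : m = fun j => (k j : ℝ) := funext hk
  have hT : torusMeasure n =
      Measure.pi fun _ : Fin n => (volume : Measure ℝ).restrict (Set.Ico (0 : ℝ) 1) := by
    rw [torusMeasure, volume_pi, Measure.restrict_pi_pi]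
  have hc : ∫ x, Complex.exp (2 * π * Complex.I * ((m ⬝ᵥ x : ℝ) : ℂ)) ∂(torusMeasure n) =
      if m = 0 then 1 else 0 := by
    have he : ∀ x : Fin n → ℝ, Complex.exp (2 * π * Complex.I * ((m ⬝ᵥ x : ℝ) : ℂ)) =
        ∏ j, Complex.exp (2 * π * Complex.I * (k j) * (x j)) := by
      intro x
      rw [← Complex.exp_sum, hmk]
      simp only [dotProduct]
      push_cast
      rw [Finset.mul_sum]
      simp only [mul_assoc]
    simp_rw [he]
    rw [hT, integral_fintype_prod_eq_prod
      (fun j (x : ℝ) => Complex.exp (2 * π * Complex.I * (k j) * x))]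
    simp_rw [integral_Ico_exp_int_mul]
    split_ifs with h
    · refine Finset.prod_eq_one fun j _ => if_pos ?_
      have := congrFun h j
      rw [hk j, Pi.zero_apply] at this
      exact_mod_cast this
    · obtain ⟨j, hj⟩ := Function.ne_iff.1 h
      refine Finset.prod_eq_zero (Finset.mem_univ j) (if_neg fun h0 => hj ?_)
      rw [hk j, h0]
      simp
  have hi : Integrable (fun x => Complex.exp (2 * π * Complex.I * ((m ⬝ᵥ x : ℝ) : ℂ)))
      (torusMeasure n) := by
    refine Integrable.of_bound (C := 1) ?_ (.of_forall fun x => ?_)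
    · refine Continuous.aestronglyMeasurable ?_
      unfold dotProduct
      fun_prop
    · rw [show 2 * π * Complex.I * ((m ⬝ᵥ x : ℝ) : ℂ) =
        ((2 * π * (m ⬝ᵥ x) : ℝ) : ℂ) * Complex.I by push_cast; ring, Complex.norm_exp_ofReal_mul_I]
  have hre := integral_re hi
  rw [hc] at hre
  have : ∀ x : Fin n → ℝ, Real.cos (2 * π * (m ⬝ᵥ x)) =
      RCLike.re (Complex.exp (2 * π * Complex.I * ((m ⬝ᵥ x : ℝ) : ℂ))) := by
    intro x
    rw [show 2 * π * Complex.I * ((m ⬝ᵥ x : ℝ) : ℂ) =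
        ((2 * π * (m ⬝ᵥ x) : ℝ) : ℂ) * Complex.I by push_cast; ring]
    exact (Complex.exp_ofReal_mul_I_re _).symm
  simp_rw [this, hre]
  split_ifs <;> simp

theorem integrable_torusMeasure_cos {n : ℕ} (m : Fin n → ℝ) :
    Integrable (fun x => Real.cos (2 * π * (m ⬝ᵥ x))) (torusMeasure n) := by
  refine Integrable.of_bound (C := 1) ?_ (.of_forall fun x => Real.abs_cos_le_one _)
  refine Continuous.aestronglyMeasurable ?_
  unfold dotProduct
  fun_prop

theorem sin_mul_sin_eq_cos {n : ℕ} (p q x : Fin n → ℝ) :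
    Real.sin (2 * π * (p ⬝ᵥ x)) * Real.sin (2 * π * (q ⬝ᵥ x)) =
      1 / 2 * (Real.cos (2 * π * ((p - q) ⬝ᵥ x)) - Real.cos (2 * π * ((p + q) ⬝ᵥ x))) := by
  rw [sub_dotProduct, add_dotProduct, mul_sub (2 * π), mul_add (2 * π), Real.cos_sub, Real.cos_add]
  ring

theorem integrable_torusMeasure_sin_mul_sin {n : ℕ} (p q : Fin n → ℝ) :
    Integrable (fun x => Real.sin (2 * π * (p ⬝ᵥ x)) * Real.sin (2 * π * (q ⬝ᵥ x)))
      (torusMeasure n) := by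
  simp_rw [sin_mul_sin_eq_cos]
  exact ((integrable_torusMeasure_cos _).sub (integrable_torusMeasure_cos _)).const_mul _

/-- Orthogonality of the sine functions with integer frequencies `p` and `q ≠ -p`. -/
theorem integral_torusMeasure_sin_mul_sin {n : ℕ} (p q : Fin n → ℝ)
    (hp : ∀ j, ∃ k : ℤ, p j = k) (hq : ∀ j, ∃ k : ℤ, q j = k) (hpq : p + q ≠ 0) :
    ∫ x, Real.sin (2 * π * (p ⬝ᵥ x)) * Real.sin (2 * π * (q ⬝ᵥ x)) ∂(torusMeasure n) =
      if p = q then 1 / 2 else 0 := by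
  simp_rw [sin_mul_sin_eq_cos]
  rw [integral_const_mul, integral_sub (integrable_torusMeasure_cos _)
    (integrable_torusMeasure_cos _), integral_torusMeasure_cos, integral_torusMeasure_cos,
    if_neg hpq]
  · simp only [sub_eq_zero]
    split_ifs <;> norm_num
  · intro j
    obtain ⟨a, ha⟩ := hp j
    obtain ⟨b, hb⟩ := hq j
    exact ⟨a + b, by simp [ha, hb]⟩
  · intro j
    obtain ⟨a, ha⟩ := hp j
    obtain ⟨b, hb⟩ := hq j
    exact ⟨a - b, by simp [ha, hb]⟩

theorem gradB_eq_sum_sin {n : ℕ} (B : Matrix (Fin n) (Fin n) ℝ) (𝒱 : Finset (Fin n → ℝ))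
    (a : ↥𝒱 → ℝ) (x : Fin n → ℝ) :
    gradB B 𝒱 a x =
      ∑ v : ↥𝒱, (-(2 * π * a v * Real.sin (2 * π * (B.mulVec v ⬝ᵥ x)))) • (v : Fin n → ℝ) := by
  ext k
  rw [gradB, Finset.sum_apply, Complex.im_sum, ← Finset.sum_neg_distrib]
  refine Finset.sum_congr rfl fun v _ => ?_
  rw [show 2 * π * Complex.I * ((B.mulVec v ⬝ᵥ x : ℝ) : ℂ) =
        ((2 * π * (B.mulVec v ⬝ᵥ x) : ℝ) : ℂ) * Complex.I by push_cast; ring,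
    show ∀ z : ℂ, 2 * π * (a v : ℂ) * z * ((v : Fin n → ℝ) k : ℂ) =
        ((2 * π * a v * (v : Fin n → ℝ) k : ℝ) : ℂ) * z by intro z; push_cast; ring,
    Complex.im_ofReal_mul, Complex.exp_ofReal_mul_I_im, Pi.smul_apply, smul_eq_mul]
  ring

theorem normBsq_sum_smul {n : ℕ} (B : Matrix (Fin n) (Fin n) ℝ) {ι : Type*} [Fintype ι]
    (c : ι → ℝ) (u : ι → Fin n → ℝ) :
    normBsq B (∑ i, c i • u i) = ∑ i, ∑ j, c i * c j * (B.mulVec (u i) ⬝ᵥ u j) := by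
  rw [normBsq, Matrix.mulVec_sum, sum_dotProduct]
  refine Finset.sum_congr rfl fun i _ => ?_
  rw [dotProduct_sum]
  refine Finset.sum_congr rfl fun j _ => ?_
  rw [Matrix.mulVec_smul, smul_dotProduct, dotProduct_smul, smul_eq_mul, smul_eq_mul]
  ring

/-- The mean energy `∫ ‖∇_B f‖_B²` of `f` in terms of its coefficients. -/
theorem integral_normBsq_gradB {n : ℕ} (B : Matrix (Fin n) (Fin n) ℝ) (hBpos : B.PosDef)
    (𝒱 : Finset (Fin n → ℝ)) (hint : ∀ v ∈ 𝒱, ∀ j, ∃ m : ℤ, B.mulVec v j = (m : ℝ))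
    (hne : ∀ v ∈ 𝒱, ∀ w ∈ 𝒱, v + w ≠ 0) (a : ↥𝒱 → ℝ) :
    ∫ x, normBsq B (gradB B 𝒱 a x) ∂(torusMeasure n) =
      ∑ v : ↥𝒱, 2 * π ^ 2 * normBsq B v * a v ^ 2 := by
  have hinj : Function.Injective B.mulVec := Matrix.mulVec_injective_of_isUnit hBpos.isUnit
  have hterm : ∀ (v w : ↥𝒱) (x : Fin n → ℝ),
      -(2 * π * a v * Real.sin (2 * π * (B.mulVec v ⬝ᵥ x))) *
        -(2 * π * a w * Real.sin (2 * π * (B.mulVec w ⬝ᵥ x))) * (B.mulVec v ⬝ᵥ w) =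
      (4 * π ^ 2 * a v * a w * (B.mulVec v ⬝ᵥ w)) *
        (Real.sin (2 * π * (B.mulVec v ⬝ᵥ x)) * Real.sin (2 * π * (B.mulVec w ⬝ᵥ x))) := by
    intros; ring
  simp_rw [gradB_eq_sum_sin, normBsq_sum_smul, hterm]
  have hI : ∀ v w : ↥𝒱, Integrable (fun x => (4 * π ^ 2 * a v * a w * (B.mulVec v ⬝ᵥ w)) *
        (Real.sin (2 * π * (B.mulVec v ⬝ᵥ x)) * Real.sin (2 * π * (B.mulVec w ⬝ᵥ x))))
      (torusMeasure n) :=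
    fun v w => (integrable_torusMeasure_sin_mul_sin _ _).const_mul _
  rw [integral_finsetSum _ fun v _ => integrable_finsetSum _ fun w _ => hI v w]
  refine Finset.sum_congr rfl fun v _ => ?_
  rw [integral_finsetSum _ fun w _ => hI v w]
  have hval : ∀ w : ↥𝒱, ∫ x, (4 * π ^ 2 * a v * a w * (B.mulVec v ⬝ᵥ w)) *
        (Real.sin (2 * π * (B.mulVec v ⬝ᵥ x)) * Real.sin (2 * π * (B.mulVec w ⬝ᵥ x)))
        ∂(torusMeasure n) =
      if v = w then 2 * π ^ 2 * normBsq B v * a v ^ 2 else 0 := by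
    intro w
    rw [integral_const_mul, integral_torusMeasure_sin_mul_sin _ _ (hint v v.2) (hint w w.2)]
    · by_cases h : v = w
      · subst h
        simp only [if_true, normBsq]
        ring
      · have : B.mulVec v ≠ B.mulVec w := fun h' => h (Subtype.ext (hinj h'))
        simp [h, this]
    · rw [← Matrix.mulVec_add]
      exact fun h => hne v v.2 w w.2 (hinj (by rw [h, Matrix.mulVec_zero]))
  simp_rw [hval]
  simp

instance isFiniteMeasure_sphereUniform (ι : Type*) [Fintype ι] [Nonempty ι] :
    IsFiniteMeasure (sphereUniform ι) := by
  refine ⟨?_⟩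
  have h0 : (volume : Measure (EuclideanSpace ℝ ι)).toSphere ≠ 0 := Measure.toSphere_ne_zero _
  rw [sphereUniform, Measure.smul_apply, smul_eq_mul]
  exact ENNReal.mul_lt_top (ENNReal.inv_lt_top.2 (Measure.measure_univ_pos.2 h0))
    (measure_lt_top _ _)

/-- The second moment of a diagonal quadratic form under the uniform measure on the sphere of
radius `√2`. -/
theorem integral_coeffMeasure_sq_sum {n : ℕ} (𝒱 : Finset (Fin n → ℝ)) (h𝒱 : 𝒱.Nonempty)
    (b : ↥𝒱 → ℝ) :
    ∫ a, (∑ v, b v * a v ^ 2) ^ 2 ∂(coeffMeasure 𝒱) =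
      4 / ((𝒱.card : ℝ) * (𝒱.card + 2)) * ((∑ v, b v) ^ 2 + 2 * ∑ v, b v ^ 2) := by
  classical
  have : Nonempty ↥𝒱 := h𝒱.to_subtype
  rw [coeffMeasure, integral_map (by fun_prop)
    (Continuous.aestronglyMeasurable (by fun_prop))]
  have hexp : ∀ c : Metric.sphere (0 : EuclideanSpace ℝ ↥𝒱) 1,
      (∑ v, b v * (Real.sqrt 2 * (c : EuclideanSpace ℝ ↥𝒱) v) ^ 2) ^ 2 =
      ∑ v, ∑ w, 4 * b v * b w *
        ((c : EuclideanSpace ℝ ↥𝒱) v ^ 2 * (c : EuclideanSpace ℝ ↥𝒱) w ^ 2) := by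
    intro c
    rw [sq, Finset.sum_mul_sum]
    refine Finset.sum_congr rfl fun v _ => Finset.sum_congr rfl fun w _ => ?_
    rw [mul_pow, mul_pow, Real.sq_sqrt zero_le_two]
    ring
  have hI : ∀ v w : ↥𝒱, Integrable
      (fun c : Metric.sphere (0 : EuclideanSpace ℝ ↥𝒱) 1 => 4 * b v * b w *
        ((c : EuclideanSpace ℝ ↥𝒱) v ^ 2 * (c : EuclideanSpace ℝ ↥𝒱) w ^ 2))
      (sphereUniform ↥𝒱) := fun v w =>
    Continuous.integrable_of_hasCompactSupport (by fun_prop) (.of_compactSpace _)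
  simp_rw [hexp]
  rw [integral_finsetSum _ fun v _ => integrable_finsetSum _ fun w _ => hI v w]
  simp_rw [integral_finsetSum _ fun w _ => hI _ w, integral_const_mul,
    integral_sphereUniform_sq_mul_sq, Fintype.card_coe]
  have hsplit : ∀ v w : ↥𝒱, 4 * b v * b w *
      ((if v = w then 3 else 1) / ((𝒱.card : ℝ) * (𝒱.card + 2))) =
      4 / ((𝒱.card : ℝ) * (𝒱.card + 2)) *
        (b v * b w + 2 * if v = w then b v ^ 2 else 0) := by
    intro v w
    by_cases h : v = w
    · subst h; simp only [if_true]; ring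
    · simp only [h, if_false]; ring
  simp_rw [hsplit, ← Finset.mul_sum, Finset.sum_add_distrib, ← Finset.mul_sum,
    Finset.sum_ite_eq, Finset.mem_univ, if_true, ← Finset.sum_mul]
  ring

section

theorem stmt19 (n : ℕ) (B : Matrix (Fin n) (Fin n) ℝ)
    (hBsymm : B.IsSymm) (hBpos : B.PosDef)
    (𝒱 : Finset (Fin n → ℝ)) (h𝒱 : 𝒱.Nonempty)
    (hint : ∀ v ∈ 𝒱, ∀ j, ∃ m : ℤ, B.mulVec v j = (m : ℝ))
    (hne : ∀ v ∈ 𝒱, ∀ w ∈ 𝒱, v + w ≠ 0) :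
    (∫ a, (∫ x, normBsq B (gradB B 𝒱 a x) ∂(torusMeasure n)) ^ 2 ∂(coeffMeasure 𝒱))
      = ((2 * π) ^ 4 / ((𝒱.card : ℝ) * ((𝒱.card : ℝ) + 2))) *
        ((∑ v ∈ 𝒱, normBsq B v) ^ 2 + 2 * ∑ v ∈ 𝒱, (normBsq B v) ^ 2) := by
  simp_rw [integral_normBsq_gradB B hBpos 𝒱 hint hne]
  rw [integral_coeffMeasure_sq_sum 𝒱 h𝒱, ← Finset.sum_coe_sort 𝒱 (fun v => normBsq B v),
    ← Finset.sum_coe_sort 𝒱 (fun v => normBsq B v ^ 2)]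
  simp_rw [mul_pow, ← Finset.mul_sum]
  ring

end
end
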